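/- Let R be a commutative ring and let a, b : ℕ → R be sequences. Then (for all n, a_n = Σ_{k=0}^{⌊n/2⌋} (C(n,k) − C(n,k−1)) · b_{n−2k}) holds if and only if (for all n, b_n = Σ_{k=0}^{⌊n/2⌋} (−1)^k · C(n−k, k) · a_{n−2k}) holds, where C(·,·) is the binomial coefficient (with C(n,−1) = 0). -/

import Mathlib

open Finset

/-- The binomial coefficient with integer lower argument, zero on negative arguments. -/
def ch (m : ℕ) (j : ℤ) : ℤ := if 0 ≤ j then m.choose j.toNat else 0

def cc (n k : ℕ) : ℤ := ch n (k : ℤ) - ch n ((k : ℤ) - 1)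

lemma ch_nat (n k : ℕ) : ch n (k : ℤ) = n.choose k := by simp [ch]

lemma cc_zero (n : ℕ) : cc n 0 = 1 := by simp [cc, ch]

lemma cc_succ (n k : ℕ) : cc n (k+1) = n.choose (k+1) - n.choose k := by
  have h : ((k+1 : ℕ) : ℤ) - 1 = (k : ℕ) := by push_cast; ring
  rw [cc, h, ch_nat, ch_nat]

lemma cc_rec (n k : ℕ) : cc (n+1) (k+1) = cc n (k+1) + cc n k := by
  cases k with
  | zero => rw [cc_succ, cc_succ, cc_zero]; simp
  | succ k =>
    rw [cc_succ, cc_succ, cc_succ, Nat.choose_succ_succ, Nat.choose_succ_succ n k]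
    push_cast; ring

lemma cc_mid (n k : ℕ) (h : 2 * k = n + 1) : cc n k = 0 := by
  cases k with
  | zero => omega
  | succ k =>
    rw [cc_succ, Nat.choose_symm_of_eq_add (show n = (k+1) + k by omega)]; simp

section
variable {R : Type*} [CommRing R]

def BB (a : ℕ → R) (n : ℕ) : R := ∑ k ∈ Finset.range (n/2 + 1),
        (-1 : R) ^ k * ((n - k).choose k : R) * a (n - 2*k)

lemma BB_eq (a : ℕ → R) (n N : ℕ) (h : n/2 + 1 ≤ N) :
    BB a n = ∑ k ∈ Finset.range N, (-1 : R) ^ k * ((n - k).choose k : R) * a (n - 2*k) := by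
  apply Finset.sum_subset
  · intro x; simp only [Finset.mem_range]; omega
  · intro x _ hx
    simp only [Finset.mem_range] at hx
    rw [Nat.choose_eq_zero_of_lt (by omega)]; simp

lemma BB_rec (a : ℕ → R) (n : ℕ) :
    BB (fun i => a (i+1)) (n+1) = BB a (n+2) + BB a n := by
  rw [BB_eq _ (n+1) (n+1+1) (by omega), BB_eq a (n+2) (n+1+1) (by omega),
    BB_eq a n (n+1) (by omega), Finset.sum_range_succ', Finset.sum_range_succ' _ (n+1),
    add_right_comm, ← Finset.sum_add_distrib]
  congr 1
  · apply Finset.sum_congr rfl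
    intro k hk
    simp only [Finset.mem_range] at hk
    rw [show n + 1 - (k+1) = n - k by omega, show n + 2 - (k+1) = (n - k) + 1 by omega,
      Nat.choose_succ_succ, show n + 2 - 2*(k+1) = n - 2*k by omega]
    by_cases h : 2*k+1 ≤ n
    · rw [show n + 1 - 2*(k+1) + 1 = n - 2*k by omega]
      push_cast; ring
    · rw [Nat.choose_eq_zero_of_lt (show n - k < k.succ by omega)]
      push_cast; ring

lemma BB_shift0 (a : ℕ → R) : BB (fun i => a (i+1)) 0 = BB a 1 := by simp [BB]

def TT (b : ℕ → R) (n k : ℕ) : R := if 2*k ≤ n then b (n - 2*k) else 0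

lemma sum_TT (b : ℕ → R) (n N : ℕ) (h : n/2 + 1 ≤ N) :
    ∑ k ∈ Finset.range (n/2+1), (cc n k : R) * b (n - 2*k)
      = ∑ k ∈ Finset.range N, (cc n k : R) * TT b n k := by
  rw [← Finset.sum_subset (s₁ := Finset.range (n/2+1)) (s₂ := Finset.range N)
    (f := fun k => (cc n k : R) * TT b n k)]
  · apply Finset.sum_congr rfl
    intro k hk
    simp only [Finset.mem_range] at hk
    rw [TT, if_pos (by omega)]
  · intro x; simp only [Finset.mem_range]; omega
  · intro x _ hx
    simp only [Finset.mem_range] at hx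
    rw [TT, if_neg (by omega), mul_zero]

lemma TT_rec (a : ℕ → R) (n k : ℕ) : (cc n k : R) * TT (BB (fun i => a (i+1))) n k
    = (cc n k : R) * TT (BB a) (n+1) k + (cc n k : R) * TT (BB a) (n+1) (k+1) := by
  rcases lt_trichotomy (2*k) n with h | h | h
  · obtain ⟨m, rfl⟩ : ∃ m, n = 2*k + m + 1 := ⟨n - 2*k - 1, by omega⟩
    rw [TT, TT, TT, if_pos (by omega), if_pos (by omega), if_pos (by omega),
      show 2*k+m+1 - 2*k = m+1 by omega, BB_rec, show 2*k+m+1+1 - 2*k = m+2 by omega,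
      show 2*k+m+1+1 - 2*(k+1) = m by omega, mul_add]
  · subst h
    rw [TT, TT, TT, if_pos (by omega), if_pos (by omega), if_neg (by omega),
      show 2*k - 2*k = 0 by omega, BB_shift0, show 2*k+1 - 2*k = 1 by omega]
    simp
  · by_cases h2 : 2*k = n+1
    · rw [cc_mid n k h2]; simp
    · rw [TT, TT, TT, if_neg (by omega), if_neg (by omega), if_neg (by omega)]; simp

lemma inv_main (n : ℕ) : ∀ a : ℕ → R,
    a n = ∑ k ∈ Finset.range (n/2+1), (cc n k : R) * BB a (n - 2*k) := by
  induction n with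
  | zero => intro a; simp [cc_zero, BB]
  | succ n ih =>
    intro a
    have h := ih (fun i => a (i+1))
    rw [sum_TT _ n (n+2) (by omega)] at h
    rw [sum_TT _ (n+1) (n+2) (by omega), h]
    simp only [TT_rec]
    rw [Finset.sum_add_distrib, Finset.sum_range_succ' (fun k => (cc (n+1) k : R) * _)]
    simp only [cc_rec, Int.cast_add, add_mul, Finset.sum_add_distrib]
    rw [Finset.sum_range_succ' (fun k => (cc n k : R) * TT (BB a) (n+1) k),
      Finset.sum_range_succ (fun k => (cc n k : R) * TT (BB a) (n+1) (k+1)) (n+1)]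
    rw [cc_zero, cc_zero, show TT (BB a) (n+1) (n+1+1) = 0 by rw [TT, if_neg (by omega)]]
    ring

end

/-- The inverse relation used for the Touchard–Riordan formula. -/
theorem stmt18 {R : Type*} [CommRing R] (a b : ℕ → R) :
    (∀ n : ℕ, a n = ∑ k ∈ Finset.range (n/2 + 1),
        ((ch n (k : ℤ) - ch n ((k : ℤ) - 1) : ℤ) : R) * b (n - 2*k))
    ↔ (∀ n : ℕ, b n = ∑ k ∈ Finset.range (n/2 + 1),
        (-1 : R) ^ k * ((n - k).choose k : R) * a (n - 2*k)) := by
  change (∀ n : ℕ, a n = ∑ k ∈ Finset.range (n/2 + 1), (cc n k : R) * b (n - 2*k))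
    ↔ (∀ n : ℕ, b n = BB a n)
  constructor
  · intro h n
    induction n using Nat.strong_induction_on with
    | _ n ih =>
      have h1 := (h n).symm.trans (inv_main n a)
      rw [Finset.sum_range_succ', Finset.sum_range_succ' _ (n/2)] at h1
      rw [Finset.sum_congr rfl (g := fun k => (cc n (k+1) : R) * BB a (n - 2*(k+1)))] at h1
      · simpa [cc_zero] using h1
      · intro k hk
        simp only [Finset.mem_range] at hk
        rw [ih _ (by omega)]
  · intro h n
    rw [show b = BB a from funext h]
    exact inv_main n a
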